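/- Let m ≥ 1 and N ≥ 2 be integers and let p be a real number with 1 < p ≤ N − 1. Suppose a_1,…,a_m : [0,∞) → [0,∞) are continuous and f_1,…,f_m satisfy (C1)–(C2). Let z : [0,∞) → [0,∞) be a continuous nondecreasing function satisfying z(r) = z(0) + ∫_0^r ( t^{1−N} ∫_0^t s^{N−1} ( Σ_{i=1}^m a_i(s) ) ( Σ_{i=1}^m f_i(z(s),…,z(s)) ) ds )^{1/(p−1)} dt for all r ≥ 0, and let β ∈ (0, z(0)]. Define u_i^0 ≡ β and, for k ≥ 1, u_i^k(r) = β + ∫_0^r ( t^{1−N} ∫_0^t s^{N−1} a_i(s) f_i(u_1^{k−1}(s),…,u_m^{k−1}(s)) ds )^{1/(p−1)} dt. Then u_i^k(r) ≤ z(r) for all i = 1,…,m, all k ≥ 0 and all r ≥ 0. -/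

import Mathlib

open Real MeasureTheory Filter Set intervalIntegral

/-- `F(s) = ∫_0^s Σ_{i=1}^m f_i(t,…,t) dt`. -/
noncomputable def Fsum (m : ℕ) (f : Fin m → (Fin m → ℝ) → ℝ) (s : ℝ) : ℝ :=
  ∫ t in (0:ℝ)..s, ∑ i, f i (fun _ => t)

/-- Conditions (C1)–(C2): each `f j` maps `[0,∞)^m` to `[0,∞)`, is continuously
differentiable in each variable, vanishes at the origin, is positive when all
arguments are positive, and is nondecreasing in each variable. -/
def SatC12 (m : ℕ) (f : Fin m → (Fin m → ℝ) → ℝ) : Prop :=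
  (∀ j (i : Fin m) (s : Fin m → ℝ), (∀ l, 0 ≤ s l) →
    ContDiffOn ℝ 1 (fun t => f j (Function.update s i t)) (Set.Ici 0)) ∧
  (∀ j s, (∀ l, 0 ≤ s l) → 0 ≤ f j s) ∧
  (∀ j, f j (fun _ => 0) = 0) ∧
  (∀ j s, (∀ l, 0 < s l) → 0 < f j s) ∧
  (∀ j s t, (∀ l, 0 ≤ s l) → (∀ l, s l ≤ t l) → f j s ≤ f j t)

/-- Condition (C3): `∫_1^∞ F(s)^(-1/p) ds = ∞`. -/
def SatC3 (m : ℕ) (p : ℝ) (f : Fin m → (Fin m → ℝ) → ℝ) : Prop :=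
  Tendsto (fun r => ∫ s in (1:ℝ)..r, (Fsum m f s) ^ (-1/p)) atTop atTop

/-- A radial solution of the system with coefficients `b` and initial value `β`:
`w i r = β + ∫_0^r (t^(1-N) ∫_0^t s^(N-1) b i s · f i (w₁(s),…,w_m(s)) ds)^(1/(p-1)) dt`. -/
def IsRadialSolution (m N : ℕ) (p : ℝ) (b : Fin m → ℝ → ℝ)
    (f : Fin m → (Fin m → ℝ) → ℝ) (β : ℝ) (w : Fin m → ℝ → ℝ) : Prop :=
  (∀ i, ContinuousOn (w i) (Set.Ici 0)) ∧
  (∀ i r, 0 ≤ r → 0 ≤ w i r) ∧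
  (∀ i r, 0 ≤ r → w i r = β + ∫ t in (0:ℝ)..r,
      (t ^ (1 - (N:ℝ)) * ∫ s in (0:ℝ)..t,
        s ^ ((N:ℝ) - 1) * b i s * f i (fun j => w j s)) ^ (1/(p-1)))

/-- The successive approximations `u_i^0 ≡ β`,
`u_i^(k+1)(r) = β + ∫_0^r (t^(1-N) ∫_0^t s^(N-1) a_i(s) f_i(u^k(s)) ds)^(1/(p-1)) dt`. -/
noncomputable def approx (m N : ℕ) (p : ℝ) (a : Fin m → ℝ → ℝ)
    (f : Fin m → (Fin m → ℝ) → ℝ) (β : ℝ) : ℕ → Fin m → ℝ → ℝ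
  | 0 => fun _ _ => β
  | (k+1) => fun i r => β + ∫ t in (0:ℝ)..r,
      (t ^ (1 - (N:ℝ)) * ∫ s in (0:ℝ)..t,
        s ^ ((N:ℝ) - 1) * a i s * f i (fun j => approx m N p a f β k j s)) ^ (1/(p-1))

theorem aux_mono {g h : ℝ → ℝ} {r : ℝ} (hr : 0 ≤ r) (hg : ∀ t, 0 < t → t ≤ r → 0 ≤ g t)
    (hgh : ∀ t, 0 < t → t ≤ r → g t ≤ h t) (hh : IntervalIntegrable h volume 0 r) :
    ∫ t in (0:ℝ)..r, g t ≤ ∫ t in (0:ℝ)..r, h t := by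
  rw [intervalIntegral.integral_of_le hr, intervalIntegral.integral_of_le hr]
  apply MeasureTheory.integral_mono_of_nonneg
  · exact (ae_restrict_iff' measurableSet_Ioc).2 (Eventually.of_forall fun t ht => hg t ht.1 ht.2)
  · exact (intervalIntegrable_iff_integrableOn_Ioc_of_le hr).1 hh
  · exact (ae_restrict_iff' measurableSet_Ioc).2 (Eventually.of_forall fun t ht => hgh t ht.1 ht.2)

theorem aux_nonneg {g : ℝ → ℝ} {r : ℝ} (hr : 0 ≤ r) (hg : ∀ t, 0 < t → t ≤ r → 0 ≤ g t) :
    0 ≤ ∫ t in (0:ℝ)..r, g t := by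
  have := aux_mono (g := fun _ => 0) (h := g) hr (fun _ _ _ => le_rfl) hg
  by_cases hi : IntervalIntegrable g volume 0 r
  · simpa using this hi
  · rw [intervalIntegral.integral_undef hi]

theorem aux_inner {q : ℝ} (hq : 0 ≤ q) {A G : ℝ → ℝ} (hA : ContinuousOn A (Set.Ici 0))
    (hG : MonotoneOn G (Set.Ici 0)) {r : ℝ} (hr : 0 ≤ r) :
    IntervalIntegrable (fun s => s ^ q * A s * G s) volume 0 r := by
  have hsub : uIcc 0 r ⊆ Set.Ici (0:ℝ) := by
    rw [uIcc_of_le hr]; exact fun x hx => hx.1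
  have h1 : IntervalIntegrable G volume 0 r := (hG.mono hsub).intervalIntegrable
  refine h1.continuousOn_mul (f := G) (g := fun s => s ^ q * A s) ?_
  exact ((Real.continuous_rpow_const hq).continuousOn).mul (hA.mono hsub)

theorem aux_outer {q e : ℝ} (hq : 0 ≤ q) (he : 0 ≤ e) {A G : ℝ → ℝ}
    (hA : ContinuousOn A (Set.Ici 0)) (hA0 : ∀ t, 0 ≤ t → 0 ≤ A t)
    (hG : MonotoneOn G (Set.Ici 0)) (hG0 : ∀ t, 0 ≤ t → 0 ≤ G t) {r : ℝ} (hr : 0 ≤ r) :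
    IntervalIntegrable (fun t => (t ^ (-q) * ∫ s in (0:ℝ)..t, s ^ q * A s * G s) ^ e)
      volume 0 r := by
  obtain ⟨C, hC⟩ := (isCompact_Icc (a := (0:ℝ)) (b := r)).exists_bound_of_continuousOn
    (hA.mono (fun x hx => hx.1))
  have hint := aux_inner hq hA hG hr
  have hC0 : 0 ≤ C := (norm_nonneg _).trans (hC 0 ⟨le_rfl, hr⟩)
  rw [intervalIntegrable_iff_integrableOn_Ioc_of_le hr]
  have hcont : ContinuousOn (fun t => ∫ s in (0:ℝ)..t, s ^ q * A s * G s) (Set.Icc 0 r) := by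
    have := intervalIntegral.continuousOn_primitive_interval (a := (0:ℝ)) (b := r)
      (f := fun s => s ^ q * A s * G s) (μ := volume) (by
        rw [uIcc_of_le hr]
        exact (intervalIntegrable_iff_integrableOn_Icc_of_le hr).1 hint)
    rwa [uIcc_of_le hr] at this
  refine Integrable.of_bound ?_ ((r * (C * G r)) ^ e) ?_
  · apply AEMeasurable.aestronglyMeasurable
    apply AEMeasurable.pow_const
    apply AEMeasurable.mul
    · exact (measurable_id.pow_const _).aemeasurable
    · exact (hcont.mono Ioc_subset_Icc_self).aemeasurable measurableSet_Ioc
  · refine (ae_restrict_iff' measurableSet_Ioc).2 (Eventually.of_forall fun t ht => ?_)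
    have ht0 : 0 < t := ht.1
    have hI0 : 0 ≤ ∫ s in (0:ℝ)..t, s ^ q * A s * G s :=
      aux_nonneg ht0.le fun s hs _ =>
        mul_nonneg (mul_nonneg (Real.rpow_nonneg hs.le _) (hA0 s hs.le)) (hG0 s hs.le)
    have hI1 : ∫ s in (0:ℝ)..t, s ^ q * A s * G s ≤ ∫ s in (0:ℝ)..t, t ^ q * C * G r := by
      refine aux_mono ht0.le (fun s hs _ =>
        mul_nonneg (mul_nonneg (Real.rpow_nonneg hs.le _) (hA0 s hs.le)) (hG0 s hs.le)) ?_
        intervalIntegrable_const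
      intro s hs hst
      have h1 : A s ≤ C := (le_abs_self _).trans (hC s ⟨hs.le, hst.trans ht.2⟩)
      have h2 : G s ≤ G r := hG hs.le hr (hst.trans ht.2)
      have h3 : s ^ q ≤ t ^ q := Real.rpow_le_rpow hs.le hst hq
      have h4 := hA0 s hs.le
      have h5 := hG0 s hs.le
      gcongr
    have htq : t ^ (-q) * t ^ q = 1 := by
      rw [← Real.rpow_add ht0]; simp
    have hb0 : 0 ≤ t ^ (-q) := Real.rpow_nonneg ht0.le _
    rw [Real.norm_of_nonneg (Real.rpow_nonneg (mul_nonneg hb0 hI0) _)]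
    refine Real.rpow_le_rpow (mul_nonneg hb0 hI0) ?_ he
    calc _ ≤ t ^ (-q) * ∫ s in (0:ℝ)..t, t ^ q * C * G r := mul_le_mul_of_nonneg_left hI1 hb0
      _ = (t ^ (-q) * t ^ q) * (t * (C * G r)) := by
        rw [intervalIntegral.integral_const, smul_eq_mul]; ring
      _ = t * (C * G r) := by rw [htq, one_mul]
      _ ≤ r * (C * G r) := mul_le_mul_of_nonneg_right ht.2 (mul_nonneg hC0 (hG0 r hr))

/-- Comparison of the successive approximations with a solution `z` of the scalar
comparison equation `Δ_p z = (Σ a_i)(Σ f_i(z,…,z))`: `u_i^k(r) ≤ z(r)` for all `i, k, r`. -/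
theorem stmt10 (m N : ℕ) (p : ℝ) (hm : 1 ≤ m) (hN : 2 ≤ N)
    (hp1 : 1 < p) (hpN : p ≤ (N:ℝ) - 1)
    (a : Fin m → ℝ → ℝ) (hac : ∀ j, ContinuousOn (a j) (Set.Ici 0))
    (hann : ∀ j r, 0 ≤ r → 0 ≤ a j r)
    (f : Fin m → (Fin m → ℝ) → ℝ) (hf12 : SatC12 m f)
    (z : ℝ → ℝ) (hzc : ContinuousOn z (Set.Ici 0))
    (hznn : ∀ r, 0 ≤ r → 0 ≤ z r) (hzm : MonotoneOn z (Set.Ici 0))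
    (hzeq : ∀ r, 0 ≤ r → z r = z 0 + ∫ t in (0:ℝ)..r,
      (t ^ (1 - (N:ℝ)) * ∫ s in (0:ℝ)..t,
        s ^ ((N:ℝ) - 1) * (∑ i, a i s) * (∑ i, f i (fun _ => z s))) ^ (1/(p-1)))
    (β : ℝ) (hβ0 : 0 < β) (hβz : β ≤ z 0) :
    ∀ (k : ℕ) (i : Fin m) (r : ℝ), 0 ≤ r →
      approx m N p a f β k i r ≤ z r := by
  obtain ⟨-, hf0, -, -, hfm⟩ := hf12
  have hq : (0:ℝ) ≤ (N:ℝ) - 1 := by linarith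
  have he : 0 ≤ 1 / (p - 1) := one_div_nonneg.2 (by linarith)
  have hneg : (1:ℝ) - N = -((N:ℝ) - 1) := by ring
  have hA : ContinuousOn (fun s => ∑ i, a i s) (Set.Ici 0) :=
    continuousOn_finsetSum _ fun i _ => hac i
  have hA0 : ∀ t, 0 ≤ t → 0 ≤ ∑ i, a i t := fun t ht => Finset.sum_nonneg fun i _ => hann i t ht
  have hG : MonotoneOn (fun s => ∑ i, f i (fun _ => z s)) (Set.Ici 0) := fun x hx y hy hxy =>
    Finset.sum_le_sum fun i _ => hfm i _ _ (fun _ => hznn x hx) (fun _ => hzm hx hy hxy)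
  have hG0 : ∀ t, 0 ≤ t → 0 ≤ ∑ i, f i (fun _ => z t) := fun t ht =>
    Finset.sum_nonneg fun i _ => hf0 i _ fun _ => hznn t ht
  suffices H : ∀ (k : ℕ) (i : Fin m) (r : ℝ), 0 ≤ r →
      0 ≤ approx m N p a f β k i r ∧ approx m N p a f β k i r ≤ z r from
    fun k i r hr => (H k i r hr).2
  intro k
  induction k with
  | zero =>
    intro i r hr
    exact ⟨hβ0.le, hβz.trans (hzm (Set.mem_Ici.2 le_rfl) hr hr)⟩
  | succ k ih =>
    intro i r hr
    have hin0 : ∀ s, 0 < s → 0 ≤ s ^ ((N:ℝ) - 1) * a i s *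
        f i (fun j => approx m N p a f β k j s) := fun s hs =>
      mul_nonneg (mul_nonneg (Real.rpow_nonneg hs.le _) (hann i s hs.le))
        (hf0 i _ fun j => (ih j s hs.le).1)
    have hb0 : ∀ t, 0 < t → 0 ≤ t ^ (1 - (N:ℝ)) * ∫ s in (0:ℝ)..t,
        s ^ ((N:ℝ) - 1) * a i s * f i (fun j => approx m N p a f β k j s) := fun t ht =>
      mul_nonneg (Real.rpow_nonneg ht.le _) (aux_nonneg ht.le fun s hs _ => hin0 s hs)
    simp only [approx]
    refine ⟨add_nonneg hβ0.le (aux_nonneg hr fun t ht _ => Real.rpow_nonneg (hb0 t ht) _), ?_⟩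
    rw [hzeq r hr]
    refine add_le_add hβz (aux_mono hr (fun t ht _ => Real.rpow_nonneg (hb0 t ht) _) ?_ ?_)
    · intro t ht _
      refine Real.rpow_le_rpow (hb0 t ht) ?_ he
      refine mul_le_mul_of_nonneg_left ?_ (Real.rpow_nonneg ht.le _)
      refine aux_mono ht.le (fun s hs _ => hin0 s hs) ?_ (aux_inner hq hA hG ht.le)
      intro s hs _
      have h1 : a i s ≤ ∑ i, a i s :=
        Finset.single_le_sum (f := fun i => a i s) (fun j _ => hann j s hs.le) (Finset.mem_univ i)
      have h2 : f i (fun j => approx m N p a f β k j s) ≤ ∑ i, f i (fun _ => z s) :=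
        (hfm i _ _ (fun j => (ih j s hs.le).1) (fun j => (ih j s hs.le).2)).trans
          (Finset.single_le_sum (f := fun i => f i (fun _ => z s))
            (fun j _ => hf0 j _ fun _ => hznn s hs.le) (Finset.mem_univ i))
      have h3 := hA0 s hs.le
      have h4 := hf0 i (fun j => approx m N p a f β k j s) fun j => (ih j s hs.le).1
      have h5 : 0 ≤ s ^ ((N:ℝ) - 1) := Real.rpow_nonneg hs.le _
      exact mul_le_mul (mul_le_mul_of_nonneg_left h1 h5) h2 h4 (mul_nonneg h5 h3)
    · rw [hneg]
      exact aux_outer hq he hA hA0 hG hG0 hr
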